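/- Under the model P(Y=1 | A,X) = expit(β₀A + r₀(X)), we have the identification moment condition: E[Y e^{-β₀A} - (1-Y) e^{r₀(X)} | X] = E[e^{-β₀A} | X, Y=1]·P(Y=1|X) - e^{r₀(X)}·P(Y=0|X) = 0 almost surely. -/

import Mathlib

open MeasureTheory Real

noncomputable def expit (t : ℝ) : ℝ := 1 / (1 + Real.exp (-t))

theorem stmt_7 {Ω S : Type*} [MeasurableSpace Ω] [MeasurableSpace S]
    (μ : Measure Ω) [IsProbabilityMeasure μ]
    (Y A : Ω → ℝ) (X : Ω → S) (β₀ : ℝ) (r₀ : S → ℝ)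
    (hY : ∀ ω, Y ω = 0 ∨ Y ω = 1)
    (hA : Measurable A) (hX : Measurable X) (hr : Measurable r₀)
    (hint1 : Integrable (fun ω => Real.exp (-(β₀ * A ω))) μ)
    (hint2 : Integrable (fun ω => Real.exp (r₀ (X ω))) μ)
    (hmodel : μ[Y | MeasurableSpace.comap (fun ω => (A ω, X ω)) inferInstance]
      =ᵐ[μ] fun ω => expit (β₀ * A ω + r₀ (X ω))) :
    μ[(fun ω => Y ω * Real.exp (-(β₀ * A ω)) - (1 - Y ω) * Real.exp (r₀ (X ω))) |
      MeasurableSpace.comap X inferInstance] =ᵐ[μ] 0 := by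
  have hYint : Integrable Y μ := by
    by_contra h
    rw [condExp_of_not_integrable h] at hmodel
    obtain ⟨ω, hω⟩ := hmodel.exists
    have : 0 < expit (β₀ * A ω + r₀ (X ω)) := by unfold expit; positivity
    simp at hω
    linarith
  have hm := (hA.prodMk hX).comap_le
  set m : MeasurableSpace Ω := MeasurableSpace.comap (fun ω => (A ω, X ω)) inferInstance with hm_def

  have hpair : Measurable[m] (fun ω => (A ω, X ω)) := comap_measurable _
  have hAm : Measurable[m] A := measurable_fst.comp hpair
  have hXm : Measurable[m] X := measurable_snd.comp hpair
  have hle : MeasurableSpace.comap X inferInstance ≤ m := hXm.comap_le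
  set b : Ω → ℝ := fun ω => Real.exp (r₀ (X ω)) with hb
  set g : Ω → ℝ := fun ω => Real.exp (-(β₀ * A ω)) + Real.exp (r₀ (X ω)) with hg
  have hbm : StronglyMeasurable[m] b :=
    (Real.measurable_exp.comp (hr.comp hXm)).stronglyMeasurable
  have hgm : StronglyMeasurable[m] g :=
    ((Real.measurable_exp.comp (hAm.const_mul β₀).neg).add
      (Real.measurable_exp.comp (hr.comp hXm))).stronglyMeasurable
  have hgi : Integrable g μ := hint1.add hint2
  have hYg : Integrable (Y * g) μ := by
    refine hgi.bdd_mul (c := 1) hYint.aestronglyMeasurable (Filter.Eventually.of_forall ?_)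
    intro ω
    rcases hY ω with h | h <;> simp [h]
  have hf : (fun ω => Y ω * Real.exp (-(β₀ * A ω)) - (1 - Y ω) * Real.exp (r₀ (X ω)))
      = Y * g - b := by
    funext ω
    simp only [Pi.sub_apply, Pi.mul_apply, hg, hb]
    ring
  have h1 : μ[Y * g - b | m] =ᵐ[μ] 0 := by
    have e1 := condExp_sub hYg hint2 m
    have e2 := condExp_mul_of_stronglyMeasurable_right hgm hYg hYint
    have e3 : μ[b | m] = b := condExp_of_stronglyMeasurable hm hbm hint2
    filter_upwards [e1, e2, hmodel] with ω h1 h2 h3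
    rw [h1, Pi.sub_apply, h2, e3, Pi.mul_apply, h3]
    simp only [hg, hb, expit, Pi.zero_apply]
    rw [neg_add, Real.exp_add, Real.exp_neg (r₀ (X ω))]
    have p1 := Real.exp_pos (-(β₀ * A ω))
    have p2 := Real.exp_pos (r₀ (X ω))
    generalize Real.exp (-(β₀ * A ω)) = u at *
    generalize Real.exp (r₀ (X ω)) = v at *
    have : 1 + u * v⁻¹ = (u + v) / v := by field_simp; ring
    rw [this]
    field_simp
    ring
  rw [hf]
  refine (condExp_condExp_of_le hle hm).symm.trans ?_
  refine (condExp_congr_ae h1).trans ?_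
  rw [condExp_zero]
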